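/- arXiv:1510.00276 — 3 statements merged into one kernel-verified Lean document; each statement's English description precedes it below -/
import Mathlib

section
/- Let n ∈ ℕ, p ∈ [1,∞), let (X = ℝⁿ, ‖·‖_X) be an n-dimensional normed space with open unit ball B_X and let (Y, ‖·‖_Y) be a Banach space. Fix ε ∈ (0,1) and set δ = (ε/9)^{1+n/p}. Suppose f : B_X → Y is 1-Lipschitz, Λ : X → Y is affine with Lipschitz constant at most 3, and y ∈ X, ρ > 0 satisfy y + ρB_X ⊆ B_X and (1/vol(ρB_X)) ∫_{y+ρB_X} ‖f(u) − Λ(u)‖_Y^p du ≤ δ^p ρ^p. Then ‖f(z) − Λ(z)‖_Y ≤ ερ for every z ∈ y + ρB_X. -/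
open MeasureTheory

/-- **Lemma 1.5 (proof, Section 2.1).** Let `X` be an `n`-dimensional normed space with a Haar
measure `μ`, `Y` a Banach space, `p ∈ [1,∞)`, `ε ∈ (0,1)` and `δ = (ε/9)^{1+n/p}`. If
`f : B_X → Y` is `1`-Lipschitz, `Λ : X → Y` is affine with Lipschitz constant at most `3`,
`y + ρB_X ⊆ B_X` and `(1/vol(ρB_X)) ∫_{y+ρB_X} ‖f - Λ‖^p ≤ δ^p ρ^p`, then
`‖f z - Λ z‖ ≤ ερ` for all `z ∈ y + ρB_X`. -/
theorem linfty_from_lp (n : ℕ) (hn : 1 ≤ n) (p : ℝ) (hp : 1 ≤ p)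
    (X : Type*) [NormedAddCommGroup X] [NormedSpace ℝ X] [MeasurableSpace X] [BorelSpace X]
    (hdim : Module.finrank ℝ X = n) (μ : Measure X) [μ.IsAddHaarMeasure]
    (Y : Type*) [NormedAddCommGroup Y] [NormedSpace ℝ Y] [CompleteSpace Y]
    (ε : ℝ) (hε0 : 0 < ε) (hε1 : ε < 1) (δ : ℝ) (hδ : δ = (ε / 9) ^ (1 + (n : ℝ) / p))
    (f : X → Y) (hf : LipschitzOnWith 1 f (Metric.ball 0 1))
    (Λ : X →ᵃ[ℝ] Y) (hΛ : LipschitzWith 3 Λ)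
    (y : X) (ρ : ℝ) (hρ : 0 < ρ) (hball : Metric.ball y ρ ⊆ Metric.ball 0 1)
    (hint : (μ (Metric.ball (0 : X) ρ)).toReal⁻¹ *
        ∫ u in Metric.ball y ρ, ‖f u - Λ u‖ ^ p ∂μ ≤ δ ^ p * ρ ^ p) :
    ∀ z ∈ Metric.ball y ρ, ‖f z - Λ z‖ ≤ ε * ρ := by
  have : FiniteDimensional ℝ X := Module.finite_of_finrank_pos (by omega)
  have : ProperSpace X := FiniteDimensional.proper ℝ X
  have hp0 : 0 < p := by linarith
  intro z hz
  by_contra! hcon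
  obtain ⟨s, hs⟩ : ∃ s, s = ε / 9 := ⟨_, rfl⟩
  have hs0 : 0 < s := by rw [hs]; positivity
  have hs1 : s < 1 := by rw [hs]; linarith
  have hεs : ε = 9 * s := by rw [hs]; ring
  obtain ⟨g, hg⟩ : ∃ g : X → ℝ, g = fun u => ‖f u - Λ u‖ := ⟨_, rfl⟩
  have hlip : ∀ u ∈ Metric.ball y ρ, ∀ v ∈ Metric.ball y ρ, g u - g v ≤ 4 * dist u v := by
    intro u hu v hv
    have h1 := hf.dist_le_mul u (hball hu) v (hball hv)
    have h2 := hΛ.dist_le_mul u v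
    rw [dist_eq_norm (f u)] at h1
    rw [dist_eq_norm (Λ u)] at h2
    have h3 : ‖f u - Λ u‖ ≤ ‖f v - Λ v‖ + ‖f u - f v‖ + ‖Λ u - Λ v‖ := by
      have : f u - Λ u = (f v - Λ v) + (f u - f v) - (Λ u - Λ v) := by abel
      rw [this]
      exact (norm_sub_le _ _).trans (by gcongr; exact norm_add_le _ _)
    push_cast at h1 h2
    simp only [hg]
    linarith
  have hg0 : ∀ u, 0 ≤ g u := fun u => by rw [hg]; exact norm_nonneg _
  have hcont : ContinuousOn (fun u => g u ^ p) (Metric.ball y ρ) := by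
    rw [hg]
    exact (((hf.continuousOn.mono hball).sub hΛ.continuous.continuousOn).norm).rpow_const
      (fun _ _ => Or.inr hp0.le)
  have hyb : y ∈ Metric.ball y ρ := Metric.mem_ball_self hρ
  have hInt : IntegrableOn (fun u => g u ^ p) (Metric.ball y ρ) μ := by
    have : IsFiniteMeasure (μ.restrict (Metric.ball y ρ)) :=
      isFiniteMeasure_restrict.2 measure_ball_lt_top.ne
    refine Integrable.of_bound
      (hcont.aestronglyMeasurable measurableSet_ball) ((g y + 4 * ρ) ^ p) ?_
    filter_upwards [ae_restrict_mem measurableSet_ball] with u hu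
    rw [Real.norm_of_nonneg (Real.rpow_nonneg (hg0 u) p)]
    have h1 := hlip u hu y hyb
    have h2 := Metric.mem_ball.1 hu
    exact Real.rpow_le_rpow (hg0 u) (by linarith) hp0.le
  obtain ⟨w, hw⟩ : ∃ w, w = y + (1 - s) • (z - y) := ⟨_, rfl⟩
  have hzy : ‖z - y‖ < ρ := by rw [← dist_eq_norm]; exact hz
  have hwy : dist w y ≤ (1 - s) * ρ := by
    rw [hw, dist_eq_norm, add_sub_cancel_left, norm_smul, Real.norm_of_nonneg (by linarith)]
    have : 0 ≤ 1 - s := by linarith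
    gcongr
  have hzw : dist z w ≤ s * ρ := by
    have : z - w = s • (z - y) := by rw [hw]; module
    rw [dist_eq_norm, this, norm_smul, Real.norm_of_nonneg hs0.le]
    gcongr
  have hsub : Metric.ball w (s * ρ) ⊆ Metric.ball y ρ :=
    Metric.ball_subset_ball' (by linarith)
  obtain ⟨c, hc⟩ : ∃ c, c = g z - 8 * (s * ρ) := ⟨_, rfl⟩
  have hcs : s * ρ < c := by
    have : ε * ρ < g z := by rw [hg]; exact hcon
    rw [hεs] at this
    rw [hc]; linarith
  have hsρ : 0 < s * ρ := by positivity
  have hlow : ∀ u ∈ Metric.ball w (s * ρ), c ^ p ≤ g u ^ p := by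
    intro u hu
    have h1 := hlip z hz u (hsub hu)
    have h2 := Metric.mem_ball'.1 hu
    have h3 := dist_triangle z w u
    exact Real.rpow_le_rpow (by linarith) (by linarith) hp0.le
  have hI1 : c ^ p * μ.real (Metric.ball w (s * ρ)) ≤ ∫ u in Metric.ball w (s * ρ), g u ^ p ∂μ :=
    setIntegral_ge_of_const_le_real measurableSet_ball measure_ball_lt_top.ne hlow
      (hInt.mono_set hsub)
  have hI2 : ∫ u in Metric.ball w (s * ρ), g u ^ p ∂μ ≤ ∫ u in Metric.ball y ρ, g u ^ p ∂μ :=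
    setIntegral_mono_set hInt (Filter.Eventually.of_forall fun u => Real.rpow_nonneg (hg0 u) p)
      hsub.eventuallyLE
  have hvol : μ.real (Metric.ball w (s * ρ)) = s ^ n * μ.real (Metric.ball (0 : X) ρ) := by
    rw [measureReal_def, measureReal_def, Measure.addHaar_ball_mul_of_pos μ w hs0, hdim,
      ENNReal.toReal_mul, ENNReal.toReal_ofReal (by positivity)]
  have hV : 0 < μ.real (Metric.ball (0 : X) ρ) :=
    ENNReal.toReal_pos (Metric.measure_ball_pos μ _ hρ).ne' measure_ball_lt_top.ne
  have hδp : δ ^ p * ρ ^ p = s ^ n * (s * ρ) ^ p := by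
    rw [hδ, ← hs, ← Real.rpow_mul hs0.le, Real.mul_rpow hs0.le hρ.le, ← Real.rpow_natCast,
      ← mul_assoc, ← Real.rpow_add hs0]
    congr 2
    field_simp
    ring
  have hI3 : ∫ u in Metric.ball y ρ, g u ^ p ∂μ ≤
      s ^ n * (s * ρ) ^ p * μ.real (Metric.ball (0 : X) ρ) := by
    rw [hδp, ← measureReal_def, inv_mul_le_iff₀ hV] at hint
    rw [hg, mul_comm]
    exact hint
  rw [hvol] at hI1
  have hlt : (s * ρ) ^ p < c ^ p := Real.rpow_lt_rpow hsρ.le hcs hp0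
  have hpos : 0 < s ^ n * μ.real (Metric.ball (0 : X) ρ) := by positivity
  nlinarith [mul_lt_mul_of_pos_right hlt hpos]
end

section
/- There exists a universal constant C ∈ (0,∞) with the following property. For every ε ∈ (0,1) and p ∈ [1,∞) there exists a 1-Lipschitz function f : ℝ → ℓ_p such that for every q ∈ [1,∞), every affine mapping Λ : ℝ → ℓ_p and all a, b ∈ ℝ with −1 ≤ a < b ≤ 1: if (b−a)/2 ≥ 4·exp(−(C/ε)^p), then ((1/(b−a)) ∫_a^b ‖f(x) − Λ(x)‖_p^q dx)^{1/q} > ε·(b−a)/2. -/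
open MeasureTheory

lemma saw_jensen (g : ℝ → ℝ) (hg : Continuous g) (h0 : ∀ x, 0 ≤ g x) (q a b m : ℝ)
    (hq : 1 ≤ q) (hab : a < b) (hm : m * (b - a) < ∫ x in a..b, g x) :
    m < ((b - a)⁻¹ * ∫ x in Set.Ioo a b, g x ^ q) ^ (1 / q) := by
  have hba : 0 < b - a := sub_pos.2 hab
  have hq0 : 0 < q := by linarith
  have hgq : Continuous (fun x => g x ^ q) :=
    hg.rpow_const (fun x => Or.inr hq0.le)
  have key := (convexOn_rpow hq).map_set_average_le (μ := volume) (t := Set.Ioo a b) (f := g)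
    (Real.continuous_rpow_const hq0.le).continuousOn isClosed_Ici
    (by simp [hab]) (by simp) (Filter.Eventually.of_forall h0)
    ((hg.integrableOn_Icc (a := a) (b := b)).mono_set Set.Ioo_subset_Icc_self)
    ((hgq.integrableOn_Icc (a := a) (b := b)).mono_set Set.Ioo_subset_Icc_self)
  rw [setAverage_eq, setAverage_eq] at key
  simp only [Real.volume_real_Ioo_of_le hab.le, smul_eq_mul] at key
  have h1 : m < (b - a)⁻¹ * ∫ x in Set.Ioo a b, g x := by
    rw [intervalIntegral.integral_of_le hab.le, integral_Ioc_eq_integral_Ioo] at hm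
    rw [inv_mul_eq_div, lt_div_iff₀ hba]
    exact hm
  have hn : 0 ≤ (b - a)⁻¹ * ∫ x in Set.Ioo a b, g x :=
    mul_nonneg (inv_nonneg.2 hba.le) (integral_nonneg h0)
  refine h1.trans_le ?_
  have h2 := Real.rpow_le_rpow (by positivity) key (by positivity : 0 ≤ 1 / q)
  rwa [← Real.rpow_mul hn, mul_one_div_cancel hq0.ne', Real.rpow_one] at h2

lemma saw_sin_int (a τ : ℝ) (hτ : 0 < τ) :
    ∫ x in a..(a + Real.pi * τ), Real.sin (x / τ) ^ 2 = τ * Real.pi / 2 := by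
  rw [intervalIntegral.integral_comp_div (fun x => Real.sin x ^ 2) hτ.ne', integral_sin_sq]
  have : (a + Real.pi * τ) / τ = a / τ + Real.pi := by field_simp
  rw [this, Real.sin_add_pi, Real.cos_add_pi, smul_eq_mul]
  ring

lemma saw_int (g : ℝ → ℝ) (hg : Continuous g) (h0 : ∀ x, 0 ≤ g x) (a b τ α : ℝ) (hτ : 0 < τ)
    (hab : a + 3 * (Real.pi * τ) ≤ b)
    (h : ∀ x, 4 * α * τ * Real.sin (x / τ) ^ 2 ≤
      g x + 2 * g (x + Real.pi * τ) + g (x + 2 * (Real.pi * τ))) :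
    Real.pi * α * τ ^ 2 ≤ ∫ x in a..b, g x := by
  have hI : ∀ u v, IntervalIntegrable g volume u v := fun u v => hg.intervalIntegrable u v
  have hpt : 0 < Real.pi * τ := mul_pos Real.pi_pos hτ
  set d := Real.pi * τ with hd
  have e1 : ∫ x in a..(a + d), 4 * α * τ * Real.sin (x / τ) ^ 2 ≤
      ∫ x in a..(a + d), (g x + 2 * g (x + d) + g (x + 2 * d)) := by
    apply intervalIntegral.integral_mono_on (by linarith)
    · exact Continuous.intervalIntegrable (by fun_prop) _ _
    · exact Continuous.intervalIntegrable (by fun_prop) _ _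
    · exact fun x _ => h x
  rw [intervalIntegral.integral_const_mul, saw_sin_int a τ hτ,
    intervalIntegral.integral_add (Continuous.intervalIntegrable (by fun_prop) _ _)
      (Continuous.intervalIntegrable (by fun_prop) _ _),
    intervalIntegral.integral_add (Continuous.intervalIntegrable (by fun_prop) _ _)
      (Continuous.intervalIntegrable (by fun_prop) _ _),
    intervalIntegral.integral_const_mul, intervalIntegral.integral_comp_add_right,
    intervalIntegral.integral_comp_add_right] at e1
  rw [show a + d + d = a + 2 * d by ring, show a + d + 2 * d = a + 3 * d by ring] at e1
  have s1 := intervalIntegral.integral_add_adjacent_intervals (hI a (a + d)) (hI (a + d) (a + 2 * d))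
  have s2 := intervalIntegral.integral_add_adjacent_intervals (hI a (a + 2 * d))
    (hI (a + 2 * d) (a + 3 * d))
  have s3 := intervalIntegral.integral_add_adjacent_intervals (hI a (a + 3 * d)) (hI (a + 3 * d) b)
  have p1 := intervalIntegral.integral_nonneg (μ := volume) (show a ≤ a + d by linarith) (fun x _ => h0 x)
  have p2 := intervalIntegral.integral_nonneg (μ := volume) (show a + 2 * d ≤ a + 3 * d by linarith)
    (fun x _ => h0 x)
  have p3 := intervalIntegral.integral_nonneg (μ := volume) hab (fun x _ => h0 x)
  have e2 : 4 * α * τ * (τ * Real.pi / 2) = 2 * (Real.pi * α * τ ^ 2) := by ring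
  linarith

lemma saw_scale (M t : ℝ) (ht1 : t ≤ 1) (ht : 4 * Real.exp (-M) ≤ t) :
    ∃ k : ℕ, k < ⌊2 * M⌋₊ ∧ (1 / 2 : ℝ) ^ k ≤ 2 * t ∧ t ≤ (1 / 2 : ℝ) ^ k := by
  have ht0 : 0 < t := lt_of_lt_of_le (by positivity) ht
  obtain ⟨k, h1, h2⟩ := exists_nat_pow_near_of_lt_one ht0 ht1
    (by norm_num : (0 : ℝ) < 1 / 2) (by norm_num)
  refine ⟨k, ?_, ?_, h2⟩
  · rw [Nat.lt_iff_add_one_le]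
    apply Nat.le_floor
    push_cast
    by_contra hc
    push Not at hc
    have h3 : Real.exp (-((k + 1 : ℝ) / 2)) ≤ Real.exp (-M) :=
      Real.exp_le_exp.2 (by linarith)
    have h4 : Real.exp (-((k + 1 : ℝ) / 2)) = Real.exp (-(1 / 2)) ^ (k + 1) := by
      rw [← Real.exp_nat_mul]; congr 1; push_cast; ring
    have h5 : (1 / 2 : ℝ) ≤ Real.exp (-(1 / 2)) := by
      have := Real.add_one_le_exp (-(1 / 2) : ℝ); linarith
    have h6 : (1 / 2 : ℝ) ^ (k + 1) ≤ Real.exp (-(1 / 2)) ^ (k + 1) :=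
      pow_le_pow_left₀ (by norm_num) h5 _
    have h7 : (0 : ℝ) < (1 / 2) ^ k := by positivity
    rw [pow_succ] at h6
    linarith
  · rw [pow_succ] at h1; linarith

lemma saw_const (ε p : ℝ) (hε : 0 < ε) (hp : 1 ≤ p) :
    (⌊2 * (1 / 160 / ε) ^ p⌋₊ : ℝ) * (80 * ε) ^ p ≤ 1 := by
  have h1 : (⌊2 * (1 / 160 / ε) ^ p⌋₊ : ℝ) ≤ 2 * (1 / 160 / ε) ^ p := Nat.floor_le (by positivity)
  have h2 : (1 / 160 / ε) ^ p * (80 * ε) ^ p = (1 / 2 : ℝ) ^ p := by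
    rw [← Real.mul_rpow (by positivity) (by positivity)]
    congr 1
    field_simp
    norm_num
  have h3 : (1 / 2 : ℝ) ^ p ≤ (1 / 2 : ℝ) ^ (1 : ℝ) :=
    Real.rpow_le_rpow_of_exponent_ge (by norm_num) (by norm_num) hp
  rw [Real.rpow_one] at h3
  calc _ ≤ 2 * (1 / 160 / ε) ^ p * (80 * ε) ^ p := by gcongr
    _ = 2 * ((1 / 160 / ε) ^ p * (80 * ε) ^ p) := by ring
    _ ≤ 1 := by rw [h2]; linarith

/-- The tooth scale. -/
noncomputable def sawTau (k : ℕ) : ℝ := (1 / 2) ^ k / (3 * Real.pi)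

lemma sawTau_pos (k : ℕ) : 0 < sawTau k := by
  have := Real.pi_pos
  unfold sawTau; positivity

/-- The coordinates. -/
noncomputable def sawCoord (α : ℝ) (k : ℕ) (x : ℝ) : ℝ :=
  α * (sawTau k * Real.sin (x / sawTau k))

lemma sawCoord_lip (α : ℝ) (hα : 0 ≤ α) (k : ℕ) (x y : ℝ) :
    ‖sawCoord α k x - sawCoord α k y‖ ≤ α * |x - y| := by
  have ht := sawTau_pos k
  unfold sawCoord
  have h := Real.abs_sin_sub_sin_le (x / sawTau k) (y / sawTau k)
  rw [← sub_div, abs_div, abs_of_pos ht, le_div_iff₀ ht] at h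
  rw [← mul_sub, ← mul_sub, Real.norm_eq_abs, abs_mul, abs_mul, abs_of_nonneg hα, abs_of_pos ht]
  gcongr
  linarith

lemma sawCoord_diff (α : ℝ) (k : ℕ) (x : ℝ) (hα : 0 ≤ α) :
    4 * α * sawTau k * Real.sin (x / sawTau k) ^ 2 ≤
      ‖sawCoord α k x - 2 * sawCoord α k (x + Real.pi * sawTau k) +
        sawCoord α k (x + 2 * (Real.pi * sawTau k))‖ := by
  have ht := sawTau_pos k
  unfold sawCoord
  have e1 : (x + Real.pi * sawTau k) / sawTau k = x / sawTau k + Real.pi := by field_simp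
  have e2 : (x + 2 * (Real.pi * sawTau k)) / sawTau k = x / sawTau k + 2 * Real.pi := by field_simp
  rw [e1, e2, Real.sin_add_pi, Real.sin_add_two_pi]
  set s := Real.sin (x / sawTau k) with hs
  have e3 : α * (sawTau k * s) - 2 * (α * (sawTau k * -s)) + α * (sawTau k * s)
      = (4 * α * sawTau k) * s := by ring
  rw [e3, Real.norm_eq_abs, abs_mul, abs_of_nonneg (by positivity : 0 ≤ 4 * α * sawTau k)]
  have h1 : |s| ≤ 1 := Real.abs_sin_le_one _
  have h2 : s ^ 2 ≤ |s| := by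
    rw [← sq_abs]; nlinarith [abs_nonneg s]
  gcongr

theorem sawtooth_lower_bound :
    ∃ C : ℝ, 0 < C ∧
      ∀ (ε p : ℝ), 0 < ε → ε < 1 → 1 ≤ p →
        ∀ [Fact ((1 : ENNReal) ≤ ENNReal.ofReal p)],
          ∃ f : ℝ → lp (fun _ : ℕ => ℝ) (ENNReal.ofReal p),
            LipschitzWith 1 f ∧
              ∀ (q : ℝ), 1 ≤ q →
                ∀ (Λ : ℝ →ᵃ[ℝ] lp (fun _ : ℕ => ℝ) (ENNReal.ofReal p)) (a b : ℝ),
                  -1 ≤ a → a < b → b ≤ 1 →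
                    4 * Real.exp (-(C / ε) ^ p) ≤ (b - a) / 2 →
                      ε * ((b - a) / 2) <
                        ((b - a)⁻¹ * ∫ x in Set.Ioo a b, ‖f x - Λ x‖ ^ q) ^ (1 / q) := by
  refine ⟨1 / 160, by norm_num, ?_⟩
  intro ε p hε _ hp hfact
  have hp0 : 0 < p := by linarith
  have htr : (ENNReal.ofReal p).toReal = p := ENNReal.toReal_ofReal hp0.le
  have hPne : ENNReal.ofReal p ≠ 0 := by simpa using hp0
  set N := ⌊2 * (1 / 160 / ε) ^ p⌋₊ with hN
  have hNc := saw_const ε p hε hp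
  rw [← hN] at hNc
  have hα : 0 ≤ 80 * ε := by positivity
  let f : ℝ → lp (fun _ : ℕ => ℝ) (ENNReal.ofReal p) := fun x =>
    ∑ k ∈ Finset.range N, lp.single (ENNReal.ofReal p) k (sawCoord (80 * ε) k x)
  have hfk : ∀ x k, k < N → (f x : ℕ → ℝ) k = sawCoord (80 * ε) k x := by
    intro x k hk
    simp only [f, lp.coeFn_sum, Finset.sum_apply, lp.single_apply]
    rw [Finset.sum_eq_single k]
    · simp
    · intro j _ hj
      exact Pi.single_eq_of_ne (Ne.symm hj) _
    · intro h; exact absurd (Finset.mem_range.2 hk) h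
  have hlip : LipschitzWith 1 f := by
    apply LipschitzWith.of_dist_le_mul
    intro x y
    rw [dist_eq_norm, Real.dist_eq, NNReal.coe_one, one_mul]
    have e : f x - f y = ∑ k ∈ Finset.range N, lp.single (ENNReal.ofReal p) k
        (sawCoord (80 * ε) k x - sawCoord (80 * ε) k y) := by
      simp only [f, ← Finset.sum_sub_distrib, lp.single_sub]
    have h := lp.norm_sum_single (E := fun _ : ℕ => ℝ) (p := ENNReal.ofReal p) (by rw [htr]; exact hp0)
      (fun k => sawCoord (80 * ε) k x - sawCoord (80 * ε) k y) (Finset.range N)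
    rw [← e, htr] at h
    rw [← Real.rpow_le_rpow_iff (norm_nonneg _) (abs_nonneg _) hp0, h]
    calc _ ≤ ∑ k ∈ Finset.range N, (80 * ε * |x - y|) ^ p :=
          Finset.sum_le_sum fun k _ => Real.rpow_le_rpow (norm_nonneg _)
            (sawCoord_lip _ hα k x y) hp0.le
      _ = (N * (80 * ε) ^ p) * |x - y| ^ p := by
          rw [Finset.sum_const, Finset.card_range, nsmul_eq_mul,
            Real.mul_rpow hα (abs_nonneg _), mul_assoc]
      _ ≤ 1 * |x - y| ^ p := by gcongr
      _ = _ := one_mul _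
  refine ⟨f, hlip, ?_⟩
  intro q hq Λ a b ha hab hb hL
  obtain ⟨k, hk, hk1, hk2⟩ := saw_scale _ ((b - a) / 2) (by linarith) hL
  rw [← hN] at hk
  have hΛ : Continuous Λ := Λ.continuous_of_finiteDimensional
  have hg : Continuous (fun x => ‖f x - Λ x‖) := (hlip.continuous.sub hΛ).norm
  have ht := sawTau_pos k
  have hpi := Real.pi_pos
  have htk : 3 * (Real.pi * sawTau k) = (1 / 2 : ℝ) ^ k := by
    unfold sawTau; field_simp
  refine saw_jensen _ hg (fun x => norm_nonneg _) q a b _ hq hab ?_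
  refine lt_of_lt_of_le ?_ (saw_int _ hg (fun x => norm_nonneg _) a b (sawTau k) (80 * ε) ht
    (by linarith) ?_)
  · have h1 : (b - a) ≤ 6 * (Real.pi * sawTau k) := by linarith
    have h2 : (b - a) ^ 2 ≤ (6 * (Real.pi * sawTau k)) ^ 2 :=
      pow_le_pow_left₀ (by linarith) h1 2
    have h3 : ε * ((b - a) / 2) * (b - a) ≤ 18 * Real.pi * (ε * Real.pi * sawTau k ^ 2) := by
      nlinarith
    have h4 : 0 < ε * Real.pi * sawTau k ^ 2 := by positivity
    have h5 := Real.pi_lt_four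
    nlinarith
  · intro x
    refine (sawCoord_diff (80 * ε) k x hα).trans ?_
    set d := Real.pi * sawTau k with hd
    have hl : Λ x - (2 : ℝ) • Λ (x + d) + Λ (x + 2 * d) = 0 := by
      have e : ∀ y, Λ y = y • Λ.linear 1 + Λ 0 := by
        intro y
        have h1 := congrFun Λ.decomp y
        have h2 : Λ.linear y = y • Λ.linear 1 := by
          rw [← map_smul, smul_eq_mul, mul_one]
        simpa [h2] using h1
      rw [e x, e (x + d), e (x + 2 * d)]
      module
    have hv : f x - (2 : ℝ) • f (x + d) + f (x + 2 * d) =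
        (f x - Λ x) - (2 : ℝ) • (f (x + d) - Λ (x + d)) + (f (x + 2 * d) - Λ (x + 2 * d)) := by
      rw [← sub_eq_zero, ← hl]
      module
    have hc := lp.norm_apply_le_norm hPne (f x - (2 : ℝ) • f (x + d) + f (x + 2 * d)) k
    have hcc : (f x - (2 : ℝ) • f (x + d) + f (x + 2 * d) : lp (fun _ : ℕ => ℝ) (ENNReal.ofReal p)) k
        = sawCoord (80 * ε) k x - 2 * sawCoord (80 * ε) k (x + d) +
          sawCoord (80 * ε) k (x + 2 * d) := by
      rw [← hfk _ k hk, ← hfk _ k hk, ← hfk _ k hk]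
      rfl
    rw [hcc] at hc
    refine hc.trans ?_
    rw [hv]
    refine (norm_add_le _ _).trans ?_
    gcongr
    refine (norm_sub_le _ _).trans ?_
    rw [norm_smul, Real.norm_eq_abs, abs_two]
end

section
/- There exist universal constants K, ε₀ ∈ (0,1) with the following property. For every ε ∈ (0, ε₀], every p ∈ [1,∞) and every n ∈ ℕ there exists a function F : ℝⁿ → ℓ₂ⁿ(ℓ_p) that is 1-Lipschitz from ℓ₂ⁿ to ℓ₂ⁿ(ℓ_p), such that for every x ∈ ℝⁿ and r > exp(−n(K/ε)^p) with x + rB^n ⊆ B^n, and for every affine mapping Λ : ℝⁿ → ℓ₂ⁿ(ℓ_p), there exists z ∈ x + rB^n with ‖F(z) − Λ(z)‖_{ℓ₂ⁿ(ℓ_p)} > εr. -/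
open MeasureTheory

/-- Sawtooth wave of period `s`. -/
noncomputable def sawT (s t : ℝ) : ℝ :=
  Metric.infDist t (Set.range (fun q : ℤ => s * (q : ℝ)))

lemma sawT_lip (s t u : ℝ) : |sawT s t - sawT s u| ≤ |t - u| := by
  have h := (Metric.lipschitz_infDist_pt (Set.range (fun q : ℤ => s * (q : ℝ)))).dist_le_mul t u
  simpa [sawT, Real.dist_eq] using h

lemma sawT_int (s : ℝ) (q : ℤ) : sawT s (s * q) = 0 :=
  Metric.infDist_zero_of_mem ⟨q, rfl⟩

lemma sawT_half (s : ℝ) (hs : 0 < s) (q : ℤ) : s / 2 ≤ sawT s (s * q + s / 2) := by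
  unfold sawT
  rw [Metric.le_infDist (Set.range_nonempty _)]
  rintro _ ⟨k, rfl⟩
  rw [Real.dist_eq]
  rcases le_or_gt k q with h | h
  · have : (k : ℝ) ≤ q := by exact_mod_cast h
    refine le_trans ?_ (le_abs_self _)
    nlinarith
  · have : (q : ℝ) + 1 ≤ k := by exact_mod_cast h
    refine le_trans ?_ (neg_le_abs _)
    nlinarith

lemma sawT_memlp (p : ENNReal) (m : ℕ) (g : ℕ → ℝ) :
    Memℓp (E := fun _ : ℕ => ℝ) (fun i => if i < m then g i else 0) p := by
  refine Memℓp.of_exponent_ge (q := 0) (memℓp_zero ?_) (zero_le)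
  refine (Set.finite_lt_nat m).subset ?_
  intro i hi
  by_contra h
  simp only [Set.mem_ofPred_eq] at h hi
  exact hi (if_neg h)

/-- The one-dimensional map using `m` scales starting from scale `j * m + 1`. -/
noncomputable def sawVec (p : ENNReal) (m : ℕ) (c : ℝ) (j : ℕ) (t : ℝ) :
    lp (fun _ : ℕ => ℝ) p :=
  ⟨fun i => if i < m then c * sawT ((1 / 2 : ℝ) ^ (j * m + i + 1)) t else 0,
    sawT_memlp p m _⟩

lemma sawVec_apply (p : ENNReal) (m : ℕ) (c : ℝ) (j : ℕ) (t : ℝ) (i : ℕ) (hi : i < m) :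
    (sawVec p m c j t : ℕ → ℝ) i = c * sawT ((1 / 2 : ℝ) ^ (j * m + i + 1)) t := by
  show (if i < m then _ else _) = _
  rw [if_pos hi]

lemma sawVec_lip (p : ENNReal) (hp : 0 < p.toReal) (m : ℕ) (c : ℝ) (hc : 0 ≤ c)
    (hm : m * c ^ p.toReal ≤ 1) (j : ℕ) (t u : ℝ) :
    ‖sawVec p m c j t - sawVec p m c j u‖ ≤ |t - u| := by
  refine lp.norm_le_of_forall_sum_le hp (abs_nonneg _) ?_
  intro s
  have key : ∀ i, ‖(sawVec p m c j t - sawVec p m c j u : lp (fun _ : ℕ => ℝ) p) i‖ ^ p.toReal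
      ≤ if i < m then c ^ p.toReal * |t - u| ^ p.toReal else 0 := by
    intro i
    have e : (sawVec p m c j t - sawVec p m c j u : lp (fun _ : ℕ => ℝ) p) i =
      (if i < m then c * sawT ((1 / 2 : ℝ) ^ (j * m + i + 1)) t else 0) -
      (if i < m then c * sawT ((1 / 2 : ℝ) ^ (j * m + i + 1)) u else 0) := rfl
    rw [e]
    split_ifs with h
    · rw [← mul_sub, norm_mul, Real.norm_eq_abs, Real.norm_eq_abs, abs_of_nonneg hc,
        Real.mul_rpow hc (abs_nonneg _)]
      exact mul_le_mul_of_nonneg_left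
        (Real.rpow_le_rpow (abs_nonneg _) (sawT_lip _ _ _) hp.le) (Real.rpow_nonneg hc _)
    · simp [hp.ne']
  calc _ ≤ ∑ i ∈ s, if i < m then c ^ p.toReal * |t - u| ^ p.toReal else 0 :=
        Finset.sum_le_sum fun i _ => key i
    _ = ∑ i ∈ s.filter (· < m), c ^ p.toReal * |t - u| ^ p.toReal := by
        rw [Finset.sum_filter]
    _ ≤ ∑ i ∈ Finset.range m, c ^ p.toReal * |t - u| ^ p.toReal := by
        refine Finset.sum_le_sum_of_subset_of_nonneg ?_ ?_
        · intro i hi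
          simpa using (Finset.mem_filter.1 hi).2
        · intros; positivity
    _ = (m * c ^ p.toReal) * |t - u| ^ p.toReal := by
        simp [mul_assoc]
    _ ≤ 1 * |t - u| ^ p.toReal := by gcongr
    _ = _ := one_mul _

lemma saw_numeric (ε p : ℝ) (he : 0 < ε) (he2 : ε ≤ 1 / 32) (hp : 1 ≤ p) :
    ∃ (m : ℕ) (c : ℝ), 0 < m ∧ 0 < c ∧ m * c ^ p ≤ 1 ∧ 8 * ε < c ∧
      2 * ((1 / 32 : ℝ) / ε) ^ p ≤ m := by
  have hp0 : 0 < p := by linarith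
  set X := ((1 / 32 : ℝ) / ε) ^ p with hX
  have hX1 : 1 ≤ X := by
    apply Real.one_le_rpow _ hp0.le
    rw [le_div_iff₀ he]; linarith
  have hm1 : 2 * X ≤ (⌈2 * X⌉₊ : ℝ) := Nat.le_ceil _
  have hm2 : (⌈2 * X⌉₊ : ℝ) < 2 * X + 1 := Nat.ceil_lt_add_one (by linarith)
  set m := ⌈2 * X⌉₊
  have hm0 : (0 : ℝ) < m := by linarith
  have hcp : ((m : ℝ) ^ (-(1 / p))) ^ p = (m : ℝ)⁻¹ := by
    rw [← Real.rpow_mul hm0.le, show -(1 / p) * p = -1 by field_simp, Real.rpow_neg_one]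
  refine ⟨m, (m : ℝ) ^ (-(1 / p)), by exact_mod_cast hm0, by positivity, ?_, ?_, hm1⟩
  · rw [hcp, mul_inv_cancel₀ hm0.ne']
  · by_contra h
    push Not at h
    have h1 := Real.rpow_le_rpow (by positivity) h hp0.le
    rw [hcp, inv_le_iff_one_le_mul₀ hm0] at h1
    have h2 : X * (8 * ε) ^ p = (1 / 4 : ℝ) ^ p := by
      rw [hX, ← Real.mul_rpow (by positivity) (by positivity)]
      congr 1
      field_simp; norm_num
    have h3 : (1 / 4 : ℝ) ^ p ≤ 1 / 4 := by
      have := Real.rpow_le_rpow_of_exponent_ge (x := 1 / 4) (by norm_num) (by norm_num) hp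
      simpa using this
    have h4 : 0 < (8 * ε) ^ p := by positivity
    nlinarith

/-- **Lemma 2.8 (tensorized sawtooth).** There exist universal constants `K, ε₀ ∈ (0,1)`
such that for every `ε ∈ (0, ε₀]`, `p ∈ [1,∞)` and `n ∈ ℕ` there is a function
`F : ℝⁿ → ℓ₂ⁿ(ℓ_p)` that is `1`-Lipschitz from `ℓ₂ⁿ` to `ℓ₂ⁿ(ℓ_p)` such that for every
`x ∈ ℝⁿ` and `r > exp(-n(K/ε)^p)` with `x + rB^n ⊆ B^n` and every affine
`Λ : ℝⁿ → ℓ₂ⁿ(ℓ_p)` there exists `z ∈ x + rB^n` with `‖F z - Λ z‖ > εr`. -/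
theorem tensorized_sawtooth :
    ∃ K ε₀ : ℝ, 0 < K ∧ K < 1 ∧ 0 < ε₀ ∧ ε₀ < 1 ∧
      ∀ (ε p : ℝ), 0 < ε → ε ≤ ε₀ → 1 ≤ p → ∀ (n : ℕ), 1 ≤ n →
        ∀ [Fact ((1 : ENNReal) ≤ ENNReal.ofReal p)],
          ∃ F : EuclideanSpace ℝ (Fin n) →
              PiLp 2 (fun _ : Fin n => lp (fun _ : ℕ => ℝ) (ENNReal.ofReal p)),
            LipschitzWith 1 F ∧
              ∀ (x : EuclideanSpace ℝ (Fin n)) (r : ℝ),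
                Real.exp (-(n * (K / ε) ^ p)) < r →
                  Metric.ball x r ⊆ Metric.ball 0 1 →
                    ∀ Λ : EuclideanSpace ℝ (Fin n) →ᵃ[ℝ]
                        PiLp 2 (fun _ : Fin n => lp (fun _ : ℕ => ℝ) (ENNReal.ofReal p)),
                      ∃ z ∈ Metric.ball x r, ε * r < ‖F z - Λ z‖ := by
  refine ⟨1 / 32, 1 / 32, by norm_num, by norm_num, by norm_num, by norm_num, ?_⟩
  intro ε p he he2 hp n hn hfact
  obtain ⟨m, c, hm0, hc0, hmc, hc8, hm2⟩ := saw_numeric ε p he he2 hp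
  have hp0 : 0 < p := by linarith
  have htr : (ENNReal.ofReal p).toReal = p := ENNReal.toReal_ofReal hp0.le
  refine ⟨fun x => WithLp.toLp 2 (fun j : Fin n => sawVec (ENNReal.ofReal p) m c j (x j)), ?_, ?_⟩
  · refine LipschitzWith.of_dist_le_mul fun x y => ?_
    rw [NNReal.coe_one, one_mul, dist_eq_norm, dist_eq_norm, PiLp.norm_eq_of_L2,
      PiLp.norm_eq_of_L2]
    apply Real.sqrt_le_sqrt
    refine Finset.sum_le_sum fun j _ => ?_
    gcongr
    exact sawVec_lip _ (by rw [htr]; exact hp0) m c hc0.le (by rw [htr]; exact hmc) j (x j) (y j)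
  intro x r hr hball Λ
  have hr0 : 0 < r := (Real.exp_pos _).trans hr
  have hinst : Nonempty (Fin n) := ⟨⟨0, hn⟩⟩
  -- `r ≤ 1`
  have hr1 : r ≤ 1 := by
    by_contra hlt
    push Not at hlt
    let j0 : Fin n := ⟨0, hn⟩
    have hnorm : ‖(EuclideanSpace.single j0 (1 : ℝ))‖ = 1 := by simp
    have h1 : x + EuclideanSpace.single j0 (1 : ℝ) ∈ Metric.ball x r := by
      simpa using hlt
    have h2 : x - EuclideanSpace.single j0 (1 : ℝ) ∈ Metric.ball x r := by
      simpa using hlt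
    have h3 := hball h1
    have h4 := hball h2
    rw [mem_ball_zero_iff] at h3 h4
    have h5 := norm_sub_le (x + EuclideanSpace.single j0 (1 : ℝ))
      (x - EuclideanSpace.single j0 (1 : ℝ))
    have h6 : (x + EuclideanSpace.single j0 (1 : ℝ)) - (x - EuclideanSpace.single j0 (1 : ℝ))
      = (2 : ℝ) • EuclideanSpace.single j0 (1 : ℝ) := by rw [two_smul]; abel
    rw [h6, norm_smul, hnorm] at h5
    norm_num at h5
    linarith
  obtain ⟨k, hk1, hk2⟩ := exists_nat_pow_near_of_lt_one hr0 hr1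
    (by norm_num : (0 : ℝ) < 1 / 2) (by norm_num)
  have hkn : k < n * m := by
    by_contra hge
    push Not at hge
    have h1 : (1 / 2 : ℝ) ^ k ≤ (1 / 2 : ℝ) ^ (n * m) :=
      pow_le_pow_of_le_one (by norm_num) (by norm_num) hge
    have h2 : (1 / 2 : ℝ) ^ (n * m) = Real.exp (-((n * m : ℕ) * Real.log 2)) := by
      rw [Real.exp_neg, Real.exp_nat_mul, Real.exp_log (by norm_num), one_div, inv_pow]
    have h3 : Real.exp (-((n * m : ℕ) * Real.log 2)) ≤
        Real.exp (-(n * ((1 / 32 : ℝ) / ε) ^ p)) := by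
      apply Real.exp_le_exp.2
      apply neg_le_neg
      push_cast
      rw [mul_assoc]
      gcongr
      have := Real.log_two_gt_d9
      have : (0 : ℝ) ≤ m := by positivity
      nlinarith
    linarith
  have hjn : k / m < n := Nat.div_lt_of_lt_mul (by rwa [mul_comm])
  let j : Fin n := ⟨k / m, hjn⟩
  have him : k % m < m := Nat.mod_lt _ hm0
  have hidx : k / m * m + k % m + 1 = k + 1 := by rw [Nat.div_add_mod']
  obtain ⟨s, hs⟩ : ∃ s : ℝ, s = (1 / 2 : ℝ) ^ (k + 1) := ⟨_, rfl⟩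
  have hs0 : 0 < s := by rw [hs]; positivity
  have hsr : s < r := by rw [hs]; exact hk1
  have hrs : r ≤ 2 * s := by rw [hs, pow_succ]; linarith
  let q : ℤ := ⌊(x j - r) / s⌋ + 1
  have hq1 : x j - r < s * q := by
    have := Int.lt_floor_add_one ((x j - r) / s)
    rw [div_lt_iff₀ hs0] at this
    push_cast [q]; linarith
  have hq2 : s * q + s < x j + r := by
    have := Int.floor_le ((x j - r) / s)
    rw [le_div_iff₀ hs0] at this
    push_cast [q]; linarith
  let pt : ℝ → EuclideanSpace ℝ (Fin n) := fun t => x + EuclideanSpace.single j (t - x j)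
  have hpt : ∀ t, (pt t) j = t := by intro t; simp [pt]
  have hptb : ∀ t, x j - r < t → t < x j + r → pt t ∈ Metric.ball x r := by
    intro t h1 h2
    have : |t - x j| < r := by rw [abs_lt]; constructor <;> linarith
    simpa [pt] using this
  by_contra hcon
  push Not at hcon
  set F : EuclideanSpace ℝ (Fin n) →
      PiLp 2 (fun _ : Fin n => lp (fun _ : ℕ => ℝ) (ENNReal.ofReal p)) :=
    fun x => WithLp.toLp 2 (fun j : Fin n => sawVec (ENNReal.ofReal p) m c j (x j)) with hF
  have e0 := hcon _ (hptb (s * q) hq1 (by linarith))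
  have e1 := hcon _ (hptb (s * q + s / 2) (by linarith) (by linarith))
  have e2 := hcon _ (hptb (s * q + s) (by linarith) (by linarith))
  have hmid : pt (s * q + s / 2) = midpoint ℝ (pt (s * q)) (pt (s * q + s)) := by
    rw [midpoint_eq_smul_add]
    ext i
    by_cases hi : i = j
    · subst hi
      simp [pt]; ring
    · simp [pt, hi]; ring
  have hΛ : Λ (pt (s * q)) + Λ (pt (s * q + s)) =
      Λ (pt (s * q + s / 2)) + Λ (pt (s * q + s / 2)) := by
    rw [hmid, Λ.map_midpoint, midpoint_add_self]
  have hD : (F (pt (s * q + s / 2)) - Λ (pt (s * q + s / 2))) +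
      (F (pt (s * q + s / 2)) - Λ (pt (s * q + s / 2)))
      - ((F (pt (s * q)) - Λ (pt (s * q))) + (F (pt (s * q + s)) - Λ (pt (s * q + s))))
      = F (pt (s * q + s / 2)) + F (pt (s * q + s / 2)) - (F (pt (s * q)) + F (pt (s * q + s))) := by
    rw [sub_add_sub_comm, sub_add_sub_comm, hΛ]; abel
  have hDn : ‖F (pt (s * q + s / 2)) + F (pt (s * q + s / 2))
      - (F (pt (s * q)) + F (pt (s * q + s)))‖ ≤ 4 * (ε * r) := by
    rw [← hD]
    refine (norm_sub_le _ _).trans ?_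
    have a := norm_add_le (F (pt (s * q + s / 2)) - Λ (pt (s * q + s / 2)))
      (F (pt (s * q + s / 2)) - Λ (pt (s * q + s / 2)))
    have b := norm_add_le (F (pt (s * q)) - Λ (pt (s * q))) (F (pt (s * q + s)) - Λ (pt (s * q + s)))
    linarith
  have hD1 := (PiLp.norm_apply_le _ j).trans hDn
  have hne : ENNReal.ofReal p ≠ 0 := by simpa using hp0
  have hD2 := (lp.norm_apply_le_norm hne _ (k % m)).trans hD1
  have hval : ∀ t, (F (pt t) j : ℕ → ℝ) (k % m) = c * sawT s t := by
    intro t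
    show (sawVec (ENNReal.ofReal p) m c (k / m) ((pt t) j) : ℕ → ℝ) (k % m) = _
    rw [sawVec_apply _ _ _ _ _ _ him, hidx, ← hs, hpt]
  have hexp : ((F (pt (s * q + s / 2)) + F (pt (s * q + s / 2))
      - (F (pt (s * q)) + F (pt (s * q + s)))) j : ℕ → ℝ) (k % m)
      = (F (pt (s * q + s / 2)) j : ℕ → ℝ) (k % m) + (F (pt (s * q + s / 2)) j : ℕ → ℝ) (k % m)
      - ((F (pt (s * q)) j : ℕ → ℝ) (k % m) + (F (pt (s * q + s)) j : ℕ → ℝ) (k % m)) := rfl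
  rw [hexp, hval, hval, hval, sawT_int] at hD2
  have hz : sawT s (s * q + s) = 0 := by
    have := sawT_int s (q + 1)
    push_cast at this
    rwa [mul_add, mul_one] at this
  rw [hz] at hD2
  have hh := sawT_half s hs0 q
  have hl := (le_abs_self _).trans hD2
  have h9 : c * (s / 2) ≤ c * sawT s (s * q + s / 2) := by gcongr
  have h10 : ε * r ≤ ε * (2 * s) := by gcongr
  have h11 : 8 * ε * s < c * s := by gcongr
  linarith
end
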